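/- arXiv:2604.12055 — 3 statements merged into one kernel-verified Lean document; each statement's English description precedes it below -/
import Mathlib

section
/- Fix n ≥ 1, a symmetric 3-tensor κ_{ABC} with complex entries, and a positive-definite Hermitian n×n matrix G; define κ(Z), κ_A(Z) = Σ_{B,C} κ_{ABC} Z_B Z_C, ‖Z‖²_G, and F(Z) = κ(Z)·conj(κ(Z))/(‖Z‖²_G)³ as above. Let Z₀ ∈ ℂⁿ, Z₀ ≠ 0, with κ(Z₀) ≠ 0. Then the Fréchet derivative over ℝ of the real-valued function F on ℂⁿ∖{0} vanishes at Z₀ if and only if for every index A one has κ_A(Z₀)·‖Z₀‖²_G = κ(Z₀)·Σ_B G_{AB}·conj((Z₀)_B). -/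
open scoped BigOperators ComplexOrder

/-- The cubic Yukawa form `κ(Z) = Σ_{A,B,C} κ_{ABC} Z_A Z_B Z_C`. -/
noncomputable def kappaForm {n : ℕ} (κ : Fin n → Fin n → Fin n → ℂ) (Z : Fin n → ℂ) : ℂ :=
  ∑ A, ∑ B, ∑ C, κ A B C * Z A * Z B * Z C

/-- The quadratic form `κ_A(Z) = Σ_{B,C} κ_{ABC} Z_B Z_C`. -/
noncomputable def kappaDeriv {n : ℕ} (κ : Fin n → Fin n → Fin n → ℂ) (Z : Fin n → ℂ)
    (A : Fin n) : ℂ :=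
  ∑ B, ∑ C, κ A B C * Z B * Z C

/-- The squared `G`-norm `‖Z‖²_G = Σ_{A,B} Z_A G_{AB} conj(Z_B)`. -/
noncomputable def gNormSq {n : ℕ} (G : Matrix (Fin n) (Fin n) ℂ) (Z : Fin n → ℂ) : ℂ :=
  ∑ A, ∑ B, Z A * G A B * (starRingEnd ℂ) (Z B)

/-- The real-valued functional `F(Z) = κ(Z)·conj(κ(Z)) / (‖Z‖²_G)³`. -/
noncomputable def specialF {n : ℕ} (κ : Fin n → Fin n → Fin n → ℂ)
    (G : Matrix (Fin n) (Fin n) ℂ) (Z : Fin n → ℂ) : ℝ :=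
  Complex.normSq (kappaForm κ Z) / ((gNormSq G Z).re) ^ 3

/-- For a symmetric tensor, the polarization of the cubic form in the direction `v` is
`3 Σ_A v_A κ_A(Z)`. -/
theorem sum_polarization_kappaForm {n : ℕ} {κ : Fin n → Fin n → Fin n → ℂ}
    (hκ : ∀ A B C, κ A B C = κ B A C ∧ κ A B C = κ A C B) (Z v : Fin n → ℂ) :
    ∑ A, ∑ B, ∑ C, ((κ A B C * v A * Z B + κ A B C * Z A * v B) * Z C +
      κ A B C * Z A * Z B * v C) = 3 * ∑ A, v A * kappaDeriv κ Z A := by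
  have h₁ : ∑ A, ∑ B, ∑ C, κ A B C * v A * Z B * Z C = ∑ A, v A * kappaDeriv κ Z A := by
    simp only [kappaDeriv, Finset.mul_sum]
    exact Finset.sum_congr rfl fun A _ => Finset.sum_congr rfl fun B _ =>
      Finset.sum_congr rfl fun C _ => by ring
  have h₂ : ∑ A, ∑ B, ∑ C, κ A B C * Z A * v B * Z C =
      ∑ A, ∑ B, ∑ C, κ A B C * v A * Z B * Z C := by
    rw [Finset.sum_comm]
    exact Finset.sum_congr rfl fun A _ => Finset.sum_congr rfl fun B _ =>
      Finset.sum_congr rfl fun C _ => by rw [(hκ B A C).1]; ring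
  have h₃ : ∑ A, ∑ B, ∑ C, κ A B C * Z A * Z B * v C =
      ∑ A, ∑ B, ∑ C, κ A B C * Z A * v B * Z C := by
    refine Finset.sum_congr rfl fun A _ => ?_
    rw [Finset.sum_comm]
    exact Finset.sum_congr rfl fun B _ => Finset.sum_congr rfl fun C _ => by
      rw [(hκ A C B).2]; ring
  simp only [add_mul, Finset.sum_add_distrib]
  rw [h₃, h₂, h₁]
  ring

theorem hasDerivAt_line_apply {n : ℕ} (Z v : Fin n → ℂ) (A : Fin n) :
    HasDerivAt (fun t : ℝ => (Z + t • v) A) (v A) 0 := by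
  simpa using ((hasDerivAt_id (0 : ℝ)).ofReal_comp.mul_const (v A)).const_add (Z A)

theorem hasLineDerivAt_kappaForm {n : ℕ} {κ : Fin n → Fin n → Fin n → ℂ}
    (hκ : ∀ A B C, κ A B C = κ B A C ∧ κ A B C = κ A C B) (Z v : Fin n → ℂ) :
    HasLineDerivAt ℝ (kappaForm κ) (3 * ∑ A, v A * kappaDeriv κ Z A) Z v := by
  rw [← sum_polarization_kappaForm hκ]
  unfold HasLineDerivAt kappaForm
  refine HasDerivAt.fun_sum fun A _ => HasDerivAt.fun_sum fun B _ =>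
    HasDerivAt.fun_sum fun C _ => ?_
  simpa using (((hasDerivAt_line_apply Z v A).const_mul (κ A B C)).fun_mul
    (hasDerivAt_line_apply Z v B)).fun_mul (hasDerivAt_line_apply Z v C)

theorem hasLineDerivAt_gNormSq {n : ℕ} (G : Matrix (Fin n) (Fin n) ℂ) (Z v : Fin n → ℂ) :
    HasLineDerivAt ℝ (gNormSq G)
      (∑ A, ∑ B, (v A * G A B * (starRingEnd ℂ) (Z B) +
        Z A * G A B * (starRingEnd ℂ) (v B))) Z v := by
  unfold HasLineDerivAt gNormSq
  refine HasDerivAt.fun_sum fun A _ => HasDerivAt.fun_sum fun B _ => ?_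
  simpa using ((hasDerivAt_line_apply Z v A).mul_const (G A B)).fun_mul
    (hasDerivAt_line_apply Z v B).star

theorem conj_sum_hermitian {n : ℕ} {G : Matrix (Fin n) (Fin n) ℂ} (hG : G.IsHermitian)
    (Z v : Fin n → ℂ) :
    (starRingEnd ℂ) (∑ A, ∑ B, v A * G A B * (starRingEnd ℂ) (Z B)) =
      ∑ A, ∑ B, Z A * G A B * (starRingEnd ℂ) (v B) := by
  simp only [map_sum, map_mul, Complex.conj_conj]
  rw [Finset.sum_comm]
  refine Finset.sum_congr rfl fun A _ => Finset.sum_congr rfl fun B _ => ?_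
  have h : (starRingEnd ℂ) (G B A) = G A B := hG.apply A B
  rw [h]
  ring

theorem hasLineDerivAt_re_gNormSq {n : ℕ} {G : Matrix (Fin n) (Fin n) ℂ}
    (hG : G.IsHermitian) (Z v : Fin n → ℂ) :
    HasLineDerivAt ℝ (fun Z => (gNormSq G Z).re)
      (2 * (∑ A, v A * ∑ B, G A B * (starRingEnd ℂ) (Z B)).re) Z v := by
  have h := Complex.reCLM.hasFDerivAt.comp_hasDerivAt (0 : ℝ) (hasLineDerivAt_gNormSq G Z v)
  simp only [Finset.sum_add_distrib] at h
  rw [← conj_sum_hermitian hG Z v] at h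
  refine HasDerivAt.congr_deriv h ?_
  simp only [Complex.reCLM_apply, Complex.add_re, Complex.conj_re, Finset.mul_sum, mul_assoc]
  ring

theorem gNormSq_im {n : ℕ} {G : Matrix (Fin n) (Fin n) ℂ} (hG : G.IsHermitian)
    (Z : Fin n → ℂ) : (gNormSq G Z).im = 0 :=
  Complex.conj_eq_iff_im.mp (conj_sum_hermitian hG Z Z)

theorem gNormSq_re_pos {n : ℕ} {G : Matrix (Fin n) (Fin n) ℂ} (hG : G.PosDef)
    {Z : Fin n → ℂ} (hZ : Z ≠ 0) : 0 < (gNormSq G Z).re := by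
  have h := hG.dotProduct_mulVec_pos (star_ne_zero.mpr hZ)
  have e : star (star Z) ⬝ᵥ G.mulVec (star Z) = gNormSq G Z := by
    simp [dotProduct, Matrix.mulVec, gNormSq, Finset.mul_sum, mul_assoc]
  rw [e] at h
  exact (Complex.pos_iff.mp h).1

theorem differentiableAt_specialF {n : ℕ} (κ : Fin n → Fin n → Fin n → ℂ)
    {G : Matrix (Fin n) (Fin n) ℂ} {Z : Fin n → ℂ} (hN : (gNormSq G Z).re ≠ 0) :
    DifferentiableAt ℝ (specialF κ G) Z := by
  have hK : DifferentiableAt ℝ (kappaForm κ) Z := by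
    unfold kappaForm
    fun_prop
  have hg : DifferentiableAt ℝ (gNormSq G) Z := by
    have hconj (B : Fin n) : DifferentiableAt ℝ (fun Z : Fin n → ℂ => (starRingEnd ℂ) (Z B)) Z :=
      (differentiableAt_apply B Z).star
    unfold gNormSq
    fun_prop
  have hre : DifferentiableAt ℝ (fun Z => (kappaForm κ Z).re) Z :=
    Complex.reCLM.differentiableAt.comp Z hK
  have him : DifferentiableAt ℝ (fun Z => (kappaForm κ Z).im) Z :=
    Complex.imCLM.differentiableAt.comp Z hK
  have hgre : DifferentiableAt ℝ (fun Z => (gNormSq G Z).re) Z :=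
    Complex.reCLM.differentiableAt.comp Z hg
  unfold specialF
  simp only [Complex.normSq_apply, div_eq_mul_inv]
  exact ((hre.fun_mul hre).fun_add (him.fun_mul him)).fun_mul
    ((hgre.fun_pow 3).fun_inv (pow_ne_zero 3 hN))

theorem fderiv_specialF_apply {n : ℕ} {κ : Fin n → Fin n → Fin n → ℂ}
    (hκ : ∀ A B C, κ A B C = κ B A C ∧ κ A B C = κ A C B)
    {G : Matrix (Fin n) (Fin n) ℂ} (hG : G.IsHermitian) {Z : Fin n → ℂ}
    (hN : (gNormSq G Z).re ≠ 0) (v : Fin n → ℂ) :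
    fderiv ℝ (specialF κ G) Z v = 6 / (gNormSq G Z).re ^ 4 *
      ((starRingEnd ℂ) (kappaForm κ Z) * ∑ A, v A * (kappaDeriv κ Z A * gNormSq G Z -
        kappaForm κ Z * ∑ B, G A B * (starRingEnd ℂ) (Z B))).re := by
  rw [← (differentiableAt_specialF κ hN).lineDeriv_eq_fderiv]
  have hK := hasLineDerivAt_kappaForm hκ Z v
  have hre := Complex.reCLM.hasFDerivAt.comp_hasDerivAt (0 : ℝ) hK
  have him := Complex.imCLM.hasFDerivAt.comp_hasDerivAt (0 : ℝ) hK
  have hg : HasDerivAt _ _ (0 : ℝ) := hasLineDerivAt_re_gNormSq hG Z v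
  have hF := ((hre.mul hre).add (him.mul him)).div (hg.pow 3) (by simpa using hN)
  have hF' : HasLineDerivAt ℝ (specialF κ G) _ Z v := hF
  rw [hF'.lineDeriv]
  have hsum : ∑ A, v A * (kappaDeriv κ Z A * gNormSq G Z -
        kappaForm κ Z * ∑ B, G A B * (starRingEnd ℂ) (Z B)) =
      (∑ A, v A * kappaDeriv κ Z A) * gNormSq G Z -
        kappaForm κ Z * ∑ A, v A * ∑ B, G A B * (starRingEnd ℂ) (Z B) := by
    rw [Finset.sum_mul, Finset.mul_sum, ← Finset.sum_sub_distrib]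
    exact Finset.sum_congr rfl fun A _ => by ring
  rw [hsum]
  generalize ∑ A, v A * kappaDeriv κ Z A = d
  generalize ∑ A, v A * ∑ B, G A B * (starRingEnd ℂ) (Z B) = s
  simp [gNormSq_im hG]
  field_simp
  ring

/-- Variational characterization of the special directions: at a point `Z₀ ≠ 0` with
`κ(Z₀) ≠ 0`, the real Fréchet derivative of `F = |κ|²/‖Z‖_G⁶` vanishes if and only if
`κ_A(Z₀)·‖Z₀‖²_G = κ(Z₀)·Σ_B G_{AB}·conj((Z₀)_B)` for every index `A`. -/
theorem specialF_critical_iff_special_direction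
    (n : ℕ) (hn : 1 ≤ n)
    (κ : Fin n → Fin n → Fin n → ℂ)
    (hκ : ∀ A B C, κ A B C = κ B A C ∧ κ A B C = κ A C B)
    (G : Matrix (Fin n) (Fin n) ℂ) (hG : G.PosDef)
    (Z₀ : Fin n → ℂ) (hZ₀ : Z₀ ≠ 0) (hκZ₀ : kappaForm κ Z₀ ≠ 0) :
    fderiv ℝ (specialF κ G) Z₀ = 0 ↔
      ∀ A : Fin n, kappaDeriv κ Z₀ A * gNormSq G Z₀ =
        kappaForm κ Z₀ * ∑ B, G A B * (starRingEnd ℂ) (Z₀ B) := by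
  have hN := gNormSq_re_pos hG hZ₀
  constructor
  · intro h A
    set w : Fin n → ℂ := fun A => kappaDeriv κ Z₀ A * gNormSq G Z₀ -
      kappaForm κ Z₀ * ∑ B, G A B * (starRingEnd ℂ) (Z₀ B) with hw
    have hA := fderiv_specialF_apply hκ hG.isHermitian hN.ne'
      (Pi.single A ((starRingEnd ℂ) ((starRingEnd ℂ) (kappaForm κ Z₀) * w A)))
    have hsum : ∑ B, (Pi.single A ((starRingEnd ℂ) ((starRingEnd ℂ) (kappaForm κ Z₀) * w A)) :
        Fin n → ℂ) B * w B = (starRingEnd ℂ) ((starRingEnd ℂ) (kappaForm κ Z₀) * w A) * w A := by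
      simp [Pi.single_apply]
    have hprod (x y : ℂ) : (x * ((starRingEnd ℂ) (x * y) * y)).re = Complex.normSq (x * y) := by
      rw [show x * ((starRingEnd ℂ) (x * y) * y) = x * y * (starRingEnd ℂ) (x * y) by ring,
        Complex.mul_conj, Complex.ofReal_re]
    rw [h, hsum, hprod] at hA
    simpa [hN.ne', hκZ₀, hw, sub_eq_zero] using hA
  · intro h
    ext v
    rw [fderiv_specialF_apply hκ hG.isHermitian hN.ne']
    simp [h]
end

section
/- Fix n ≥ 1, a symmetric 3-tensor κ_{ABC} with complex entries, and a positive-definite Hermitian n×n matrix G; define κ(Z), κ_A(Z), and ‖Z‖²_G as above. Assume the cubic form κ is not identically zero. Then there exists Z₀ ∈ ℂⁿ, Z₀ ≠ 0, with κ(Z₀) ≠ 0 such that for every index A, κ_A(Z₀)·‖Z₀‖²_G = κ(Z₀)·Σ_B G_{AB}·conj((Z₀)_B). -/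
open scoped BigOperators ComplexOrder

/-- The `G`-pairing `Σ_{A,B} V_A G_{AB} conj(Z_B)`, whose diagonal is `gNormSq`. -/
noncomputable def gPairing {n : ℕ} (G : Matrix (Fin n) (Fin n) ℂ) (V Z : Fin n → ℂ) : ℂ :=
  ∑ A, ∑ B, V A * G A B * (starRingEnd ℂ) (Z B)

theorem gNormSq_eq_dotProduct {n : ℕ} (G : Matrix (Fin n) (Fin n) ℂ) (Z : Fin n → ℂ) :
    gNormSq G Z = dotProduct (star (star Z)) (G.mulVec (star Z)) := by
  simp [gNormSq, dotProduct, Matrix.mulVec, Finset.mul_sum, mul_assoc]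

theorem gNormSq_pos {n : ℕ} {G : Matrix (Fin n) (Fin n) ℂ} (hG : G.PosDef) {Z : Fin n → ℂ}
    (hZ : Z ≠ 0) : 0 < gNormSq G Z := by
  rw [gNormSq_eq_dotProduct]
  exact hG.dotProduct_mulVec_pos (star_ne_zero.mpr hZ)

theorem kappaForm_smul {n : ℕ} (κ : Fin n → Fin n → Fin n → ℂ) (c : ℂ) (Z : Fin n → ℂ) :
    kappaForm κ (c • Z) = c ^ 3 * kappaForm κ Z := by
  simp only [kappaForm, Finset.mul_sum, Pi.smul_apply, smul_eq_mul]
  refine Finset.sum_congr rfl fun A _ => Finset.sum_congr rfl fun B _ =>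
    Finset.sum_congr rfl fun C _ => ?_
  ring

theorem gNormSq_smul {n : ℕ} (G : Matrix (Fin n) (Fin n) ℂ) (c : ℂ) (Z : Fin n → ℂ) :
    gNormSq G (c • Z) = Complex.normSq c * gNormSq G Z := by
  simp only [gNormSq, Finset.mul_sum, Pi.smul_apply, smul_eq_mul, ← Complex.mul_conj, map_mul]
  refine Finset.sum_congr rfl fun A _ => Finset.sum_congr rfl fun B _ => ?_
  ring

theorem continuous_kappaForm {n : ℕ} (κ : Fin n → Fin n → Fin n → ℂ) :
    Continuous (kappaForm κ) := by
  unfold kappaForm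
  fun_prop

theorem continuous_gNormSq {n : ℕ} (G : Matrix (Fin n) (Fin n) ℂ) :
    Continuous (gNormSq G) := by
  unfold gNormSq
  have := Complex.continuous_conj
  fun_prop

/-- The functional `|κ(Z)|² / ‖Z‖_G⁶` attains its maximum, at a point where `κ` is nonzero. -/
theorem exists_max_kappaForm {n : ℕ} (κ : Fin n → Fin n → Fin n → ℂ)
    {G : Matrix (Fin n) (Fin n) ℂ} (hG : G.PosDef) (hne : ∃ W : Fin n → ℂ, kappaForm κ W ≠ 0) :
    ∃ Z₀ : Fin n → ℂ, Z₀ ≠ 0 ∧ kappaForm κ Z₀ ≠ 0 ∧ ∀ Z : Fin n → ℂ,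
      Complex.normSq (kappaForm κ Z) * (gNormSq G Z₀).re ^ 3 ≤
        Complex.normSq (kappaForm κ Z₀) * (gNormSq G Z).re ^ 3 := by
  have kappa_zero : kappaForm κ 0 = 0 := by simp [kappaForm]
  have re_pos : ∀ Z : Fin n → ℂ, Z ≠ 0 → 0 < (gNormSq G Z).re := fun Z hZ =>
    (Complex.pos_iff.mp (gNormSq_pos hG hZ)).1
  have sphere_ne : ∀ Z ∈ Metric.sphere (0 : Fin n → ℂ) 1, Z ≠ 0 := fun Z hZ =>
    ne_zero_of_mem_unit_sphere ⟨Z, hZ⟩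
  have normalize_mem : ∀ Z : Fin n → ℂ, Z ≠ 0 →
      ((‖Z‖⁻¹ : ℝ) : ℂ) • Z ∈ Metric.sphere (0 : Fin n → ℂ) 1 := fun Z hZ => by
    simp [norm_smul, inv_mul_cancel₀ (norm_ne_zero_iff.mpr hZ)]
  let F : (Fin n → ℂ) → ℝ := fun Z => Complex.normSq (kappaForm κ Z) / (gNormSq G Z).re ^ 3
  have F_normalize : ∀ Z : Fin n → ℂ, Z ≠ 0 → F (((‖Z‖⁻¹ : ℝ) : ℂ) • Z) = F Z := fun Z hZ => by
    have hn : ‖Z‖ ≠ 0 := norm_ne_zero_iff.mpr hZ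
    have hp := (re_pos Z hZ).ne'
    simp only [F, kappaForm_smul, gNormSq_smul, map_mul, map_pow, Complex.normSq_ofReal,
      Complex.re_ofReal_mul]
    field_simp
  obtain ⟨W, hW⟩ := hne
  have hW0 : W ≠ 0 := fun h => hW (h ▸ kappa_zero)
  have hcont : ContinuousOn F (Metric.sphere 0 1) := by
    refine ContinuousOn.div ?_ ?_ fun Z hZ => (pow_pos (re_pos Z (sphere_ne Z hZ)) 3).ne'
    · exact (Complex.continuous_normSq.comp (continuous_kappaForm κ)).continuousOn
    · exact ((Complex.continuous_re.comp (continuous_gNormSq G)).pow 3).continuousOn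
  obtain ⟨Z₀, hZ₀, hmax⟩ :=
    (isCompact_sphere (0 : Fin n → ℂ) 1).exists_isMaxOn ⟨_, normalize_mem W hW0⟩ hcont
  have hZ₀0 := sphere_ne Z₀ hZ₀
  have F_le : ∀ Z : Fin n → ℂ, Z ≠ 0 → F Z ≤ F Z₀ := fun Z hZ =>
    F_normalize Z hZ ▸ hmax (normalize_mem Z hZ)
  refine ⟨Z₀, hZ₀0, fun h => ?_, fun Z => ?_⟩
  · have h1 := F_le W hW0
    have h2 : 0 < F W := div_pos (Complex.normSq_pos.mpr hW) (pow_pos (re_pos W hW0) 3)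
    have h3 : F Z₀ = 0 := by simp [F, h]
    linarith
  · rcases eq_or_ne Z 0 with rfl | hZ
    · simp [kappa_zero, gNormSq]
    · exact (div_le_div_iff₀ (pow_pos (re_pos Z hZ) 3) (pow_pos (re_pos Z₀ hZ₀0) 3)).mp (F_le Z hZ)

theorem hasDerivAt_kappaForm_line {n : ℕ} {κ : Fin n → Fin n → Fin n → ℂ}
    (hκ : ∀ A B C, κ A B C = κ B A C ∧ κ A B C = κ A C B) (Z V : Fin n → ℂ) :
    HasDerivAt (fun t : ℝ => kappaForm κ (Z + (t : ℂ) • V))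
      (3 * ∑ A, V A * kappaDeriv κ Z A) 0 := by
  have hcoord : ∀ A, HasDerivAt (fun t : ℝ => Z A + (t : ℂ) * V A) (V A) 0 := fun A => by
    simpa using ((Complex.ofRealCLM.hasDerivAt (x := 0)).mul_const (V A)).const_add (Z A)
  have h : HasDerivAt (fun t : ℝ => kappaForm κ (Z + (t : ℂ) • V))
      (∑ A, ∑ B, ∑ C, (κ A B C * V A * Z B * Z C + κ A B C * Z A * V B * Z C
        + κ A B C * Z A * Z B * V C)) 0 := by
    simp only [kappaForm, Pi.add_apply, Pi.smul_apply, smul_eq_mul]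
    refine HasDerivAt.fun_sum fun A _ => HasDerivAt.fun_sum fun B _ =>
      HasDerivAt.fun_sum fun C _ => ?_
    refine ((((hcoord A).const_mul (κ A B C)).fun_mul (hcoord B)).fun_mul
      (hcoord C)).congr_deriv ?_
    simp
    ring
  have first : ∑ A, ∑ B, ∑ C, κ A B C * V A * Z B * Z C = ∑ A, V A * kappaDeriv κ Z A := by
    simp only [kappaDeriv, Finset.mul_sum]
    refine Finset.sum_congr rfl fun A _ => Finset.sum_congr rfl fun B _ =>
      Finset.sum_congr rfl fun C _ => ?_
    ring
  have second : ∑ A, ∑ B, ∑ C, κ A B C * Z A * V B * Z C = ∑ A, V A * kappaDeriv κ Z A := by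
    rw [← first, Finset.sum_comm]
    refine Finset.sum_congr rfl fun A _ => Finset.sum_congr rfl fun B _ =>
      Finset.sum_congr rfl fun C _ => ?_
    rw [(hκ B A C).1]
    ring
  have third : ∑ A, ∑ B, ∑ C, κ A B C * Z A * Z B * V C = ∑ A, V A * kappaDeriv κ Z A := by
    rw [← second]
    refine Finset.sum_congr rfl fun A _ => ?_
    rw [Finset.sum_comm]
    refine Finset.sum_congr rfl fun B _ => Finset.sum_congr rfl fun C _ => ?_
    rw [(hκ A C B).2]
    ring
  convert h using 1
  simp only [Finset.sum_add_distrib]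
  rw [first, second, third]
  ring

theorem hasDerivAt_gNormSq_line {n : ℕ} {G : Matrix (Fin n) (Fin n) ℂ} (hG : G.IsHermitian)
    (Z V : Fin n → ℂ) :
    HasDerivAt (fun t : ℝ => (gNormSq G (Z + (t : ℂ) • V)).re) (2 * (gPairing G V Z).re) 0 := by
  have hcoord : ∀ A, HasDerivAt (fun t : ℝ => Z A + (t : ℂ) * V A) (V A) 0 := fun A => by
    simpa using ((Complex.ofRealCLM.hasDerivAt (x := 0)).mul_const (V A)).const_add (Z A)
  have h : HasDerivAt (fun t : ℝ => gNormSq G (Z + (t : ℂ) • V))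
      (gPairing G V Z + gPairing G Z V) 0 := by
    simp only [gNormSq, gPairing, Pi.add_apply, Pi.smul_apply, smul_eq_mul,
      ← Finset.sum_add_distrib]
    refine HasDerivAt.fun_sum fun A _ => HasDerivAt.fun_sum fun B _ => ?_
    refine (((hcoord A).mul_const (G A B)).fun_mul (hcoord B).star).congr_deriv ?_
    simp
  have hconj : gPairing G Z V = (starRingEnd ℂ) (gPairing G V Z) := by
    simp only [gPairing, map_sum, map_mul, Complex.conj_conj]
    rw [Finset.sum_comm]
    refine Finset.sum_congr rfl fun A _ => Finset.sum_congr rfl fun B _ => ?_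
    rw [← hG.apply B A, starRingEnd_apply (G A B)]
    ring
  refine (Complex.reCLM.hasFDerivAt.comp_hasDerivAt (0 : ℝ) h).congr_deriv ?_
  simp [hconj]
  ring

/-- Existence of special directions: if the cubic form `κ` is not identically zero,
there is a `Z₀ ≠ 0` with nonvanishing Yukawa coupling satisfying the special-direction
equation `κ_A(Z₀)·‖Z₀‖²_G = κ(Z₀)·Σ_B G_{AB}·conj((Z₀)_B)` for every index `A`. -/
theorem exists_special_direction
    (n : ℕ) (hn : 1 ≤ n)
    (κ : Fin n → Fin n → Fin n → ℂ)
    (hκ : ∀ A B C, κ A B C = κ B A C ∧ κ A B C = κ A C B)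
    (G : Matrix (Fin n) (Fin n) ℂ) (hG : G.PosDef)
    (hne : ∃ W : Fin n → ℂ, kappaForm κ W ≠ 0) :
    ∃ Z₀ : Fin n → ℂ, Z₀ ≠ 0 ∧ kappaForm κ Z₀ ≠ 0 ∧
      ∀ A : Fin n, kappaDeriv κ Z₀ A * gNormSq G Z₀ =
        kappaForm κ Z₀ * ∑ B, G A B * (starRingEnd ℂ) (Z₀ B) := by
  obtain ⟨Z₀, hZ₀, hκ₀, hmax⟩ := exists_max_kappaForm κ hG hne
  refine ⟨Z₀, hZ₀, hκ₀, fun A => ?_⟩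
  obtain ⟨hpos, him⟩ := Complex.pos_iff.mp (gNormSq_pos hG hZ₀)
  have hreal : gNormSq G Z₀ = ((gNormSq G Z₀).re : ℂ) := Complex.ext rfl (by simp [← him])
  have critical : ∀ V : Fin n → ℂ,
      ((starRingEnd ℂ) (kappaForm κ Z₀) * (kappaForm κ Z₀ * gPairing G V Z₀
        - (∑ B, V B * kappaDeriv κ Z₀ B) * gNormSq G Z₀)).re = 0 := fun V => by
    have hk := hasDerivAt_kappaForm_line hκ Z₀ V
    have hg := hasDerivAt_gNormSq_line hG.isHermitian Z₀ V
    generalize ∑ B, V B * kappaDeriv κ Z₀ B = S at hk ⊢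
    have hre := Complex.reCLM.hasFDerivAt.comp_hasDerivAt (0 : ℝ) hk
    have him' := Complex.imCLM.hasFDerivAt.comp_hasDerivAt (0 : ℝ) hk
    have hf := ((hg.pow 3).const_mul (Complex.normSq (kappaForm κ Z₀))).sub
      (((hre.mul hre).add (him'.mul him')).mul_const ((gNormSq G Z₀).re ^ 3))
    have hzero := IsLocalMin.hasDerivAt_eq_zero (Filter.Eventually.of_forall fun t => by
      have := hmax (Z₀ + (t : ℂ) • V)
      simp [Complex.normSq_apply] at this ⊢
      linarith) hf
    rw [hreal]
    simp [Complex.normSq_apply] at hzero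
    have hfac : (gNormSq G Z₀).re ^ 2 ≠ 0 := by positivity
    refine (mul_eq_zero.mp ?_).resolve_left hfac
    simp only [Complex.mul_re, Complex.mul_im, Complex.sub_re, Complex.sub_im, Complex.conj_re,
      Complex.conj_im, Complex.ofReal_re, Complex.ofReal_im] at hzero ⊢
    linear_combination hzero / 6
  set E : ℂ := kappaForm κ Z₀ * (∑ B, G A B * (starRingEnd ℂ) (Z₀ B))
    - kappaDeriv κ Z₀ A * gNormSq G Z₀ with hE
  have hcrit : ∀ v : ℂ, ((starRingEnd ℂ) (kappaForm κ Z₀) * (v * E)).re = 0 := fun v => by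
    have h := critical (Pi.single A v)
    have hp : gPairing G (Pi.single A v) Z₀ = v * ∑ B, G A B * (starRingEnd ℂ) (Z₀ B) := by
      simp only [gPairing, mul_assoc, ← Finset.mul_sum]
      simp [Pi.single_apply]
    have hs : ∑ B, (Pi.single A v : Fin n → ℂ) B * kappaDeriv κ Z₀ B = v * kappaDeriv κ Z₀ A := by
      simp [Pi.single_apply]
    rw [hp, hs] at h
    rw [← h, hE]
    congr 1
    ring
  have hE0 : E = 0 := by
    have h := hcrit (kappaForm κ Z₀ * (starRingEnd ℂ) E)
    have h' : (starRingEnd ℂ) (kappaForm κ Z₀) * (kappaForm κ Z₀ * (starRingEnd ℂ) E * E)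
        = ((Complex.normSq (kappaForm κ Z₀) * Complex.normSq E : ℝ) : ℂ) := by
      rw [Complex.ofReal_mul, ← Complex.mul_conj, ← Complex.mul_conj]
      ring
    rw [h', Complex.ofReal_re] at h
    simpa [hκ₀] using h
  exact (sub_eq_zero.mp hE0).symm
end

section
/- Consider n = 2 with the symmetric 3-tensor given by κ_{112} = κ_{122} = 3 (together with all permutations of these index triples) and κ_{111} = κ_{222} = 0, so that κ(Z) = 9·Z₁·Z₂·(Z₁+Z₂), κ₁(Z) = 6Z₁Z₂ + 3Z₂², κ₂(Z) = 3Z₁² + 6Z₁Z₂, and let G be the positive-definite real symmetric matrix (1/16)·[[5,1],[1,5]]. For z ∈ ℝ put Z = (1, z) ∈ ℂ². Then the special-direction equations κ_A(Z)·‖Z‖²_G = κ(Z)·(G·Z)_A for A = 1,2 hold if and only if z ∈ { 1, (−7+2√6)/5, (−7−2√6)/5 }; in particular there are exactly three real special directions with normalization Z₁ = 1, and κ(Z) ≠ 0 at each of them. -/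
open Matrix
open scoped BigOperators

/-- The moduli-space metric of the mirror bicubic example at the symmetric background
point: `G = (1/16)·[[5,1],[1,5]]`. -/
noncomputable def bicubicG : Matrix (Fin 2) (Fin 2) ℝ :=
  (1 / 16 : ℝ) • !![5, 1; 1, 5]

/-- The real roots of `(z - 1)(5z² + 14z + 5)`. -/
lemma cubic_eq_zero_iff (z : ℝ) :
    5 * z ^ 3 + 9 * z ^ 2 - 9 * z - 5 = 0 ↔
      (z = 1 ∨ z = (-7 + 2 * Real.sqrt 6) / 5 ∨ z = (-7 - 2 * Real.sqrt 6) / 5) := by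
  have h6 : Real.sqrt 6 ^ 2 = 6 := Real.sq_sqrt (by norm_num)
  have hfac : 5 * z ^ 3 + 9 * z ^ 2 - 9 * z - 5 =
      5 * ((z - 1) * ((z - (-7 + 2 * Real.sqrt 6) / 5) * (z - (-7 - 2 * Real.sqrt 6) / 5))) := by
    linear_combination (4 / 5 * (z - 1)) * h6
  rw [hfac]
  simp only [mul_eq_zero, sub_eq_zero, OfNat.ofNat_ne_zero, false_or]

/-- The special-direction equations for `Z = (1, z)` reduce to a single cubic equation. -/
lemma special_direction_iff_cubic (z : ℝ) :
    (∀ A : Fin 2,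
        (![6 * z + 3 * z ^ 2, 3 + 6 * z] A) * (![1, z] ⬝ᵥ bicubicG.mulVec ![1, z]) =
          (9 * z * (1 + z)) * bicubicG.mulVec ![1, z] A) ↔
      5 * z ^ 3 + 9 * z ^ 2 - 9 * z - 5 = 0 := by
  simp only [Fin.forall_fin_two, bicubicG, Matrix.mulVec, dotProduct, Fin.sum_univ_two,
    Matrix.smul_apply, Matrix.of_apply, Matrix.cons_val_zero, Matrix.cons_val_one, smul_eq_mul]
  constructor
  · rintro ⟨-, h⟩
    linear_combination (-16 / 3) * h
  · intro h
    exact ⟨by linear_combination (3 / 16 * z) * h, by linear_combination (-3 / 16) * h⟩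

/-- In the mirror bicubic example, with `κ(Z) = 9·Z₁·Z₂·(Z₁+Z₂)` (so
`κ₁(Z) = 6Z₁Z₂ + 3Z₂²`, `κ₂(Z) = 3Z₁² + 6Z₁Z₂`), `G = (1/16)·[[5,1],[1,5]]`, and
`Z = (1, z)` for real `z`, the special-direction equations
`κ_A(Z)·‖Z‖²_G = κ(Z)·(G·Z)_A` (A = 1,2) hold if and only if
`z ∈ {1, (−7+2√6)/5, (−7−2√6)/5}`, and `κ(Z) ≠ 0` at each of these three values. -/
theorem bicubic_special_directions (z : ℝ) :
    ((∀ A : Fin 2,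
        (![6 * z + 3 * z ^ 2, 3 + 6 * z] A) * (![1, z] ⬝ᵥ bicubicG.mulVec ![1, z]) =
          (9 * z * (1 + z)) * bicubicG.mulVec ![1, z] A) ↔
      (z = 1 ∨ z = (-7 + 2 * Real.sqrt 6) / 5 ∨ z = (-7 - 2 * Real.sqrt 6) / 5)) ∧
    (∀ w : ℝ,
      (w = 1 ∨ w = (-7 + 2 * Real.sqrt 6) / 5 ∨ w = (-7 - 2 * Real.sqrt 6) / 5) →
        9 * w * (1 + w) ≠ 0) := by
  refine ⟨(special_direction_iff_cubic z).trans (cubic_eq_zero_iff z), fun w hw h => ?_⟩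
  have hcubic := (cubic_eq_zero_iff w).mpr hw
  have hw' : w = 0 ∨ 1 + w = 0 := by simpa using h
  rcases hw' with rfl | h
  · norm_num at hcubic
  · obtain rfl : w = -1 := by linarith
    norm_num at hcubic
end
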